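/- Let R be a commutative ring and n ≥ 2. The matrix ring Mₙ(R) of n×n matrices over R is a UNC ring if and only if J(R) is nil and R/J(R) is a Boolean ring. -/

import Mathlib

/-- An element is nil-clean if it is the sum of an idempotent and a nilpotent. -/
def IsNilClean {R : Type*} [Ring R] (a : R) : Prop :=
  ∃ e b : R, IsIdempotentElem e ∧ IsNilpotent b ∧ a = e + b

/-- A ring is a UNC ring if every unit is nil-clean. -/
def IsUNCRing (R : Type*) [Ring R] : Prop :=
  ∀ u : Rˣ, IsNilClean (u : R)

/-- If `x ^ d = x ^ k + r` is the relation satisfied by a cyclic endomorphism, with `r` of degree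
less than `k`, then the idempotent part kills `x ^ i` for `i < k`, sends `x ^ i` to `x ^ k` for
`k ≤ i < d - 1`, and sends `x ^ (d - 1)` to `x ^ (d - 1) + r`. -/
theorem isNilClean_of_cyclic {V : Type*} [AddCommGroup V] [Module (ZMod 2) V]
    (f : Module.End (ZMod 2) V) (v : V) {d : ℕ} (b : Module.Basis (Fin d) (ZMod 2) V)
    (hb : ∀ i, b i = (f ^ (i : ℕ)) v) : IsNilClean f := by
  obtain ⟨u, hu⟩ : ∃ u : ℕ → V, ∀ i, u i = (f ^ i) v := ⟨_, fun _ => rfl⟩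
  have hfu (i : ℕ) : f (u i) = u (i + 1) := by rw [hu, hu, pow_succ', Module.End.mul_apply]
  have hbu (i : Fin d) : b i = u i := by rw [hb, hu]
  by_cases hc : ∀ i, b.repr (u d) i = 0
  · refine ⟨0, f, .zero, ⟨d, b.ext fun i => ?_⟩, (zero_add f).symm⟩
    have hd : u d = 0 := b.repr.map_eq_zero_iff.1 (Finsupp.ext hc)
    rw [hbu, hu, ← Module.End.mul_apply, ← pow_add, add_comm, pow_add, Module.End.mul_apply, ← hu,
      hd, map_zero, LinearMap.zero_apply]
  · obtain ⟨k, hk, hmax⟩ : ∃ k, b.repr (u d) k ≠ 0 ∧ ∀ i, k < i → b.repr (u d) i = 0 := by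
      push Not at hc
      obtain ⟨k, hk⟩ := (Set.toFinite {i | b.repr (u d) i ≠ 0}).exists_maximal hc
      refine ⟨k, hk.1, fun i hi => ?_⟩
      by_contra h
      exact absurd (hk.2 h hi.le) (not_le.2 hi)
    have hk1 : b.repr (u d) k = 1 := by
      generalize b.repr (u d) k = x at hk
      revert hk; revert x; decide
    have hkd := k.isLt
    set E : Module.End (ZMod 2) V := b.constr ℕ fun i =>
      if i < k then 0 else if (i : ℕ) + 1 = d then u i + (u d - u k) else u k with hE
    have hElt {i : ℕ} (h : i < k) : E (u i) = 0 := by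
      rw [← hbu ⟨i, h.trans hkd⟩, hE, b.constr_basis, if_pos (Fin.lt_def.2 h)]
    have hEmid {i : ℕ} (h : k ≤ i) (h' : i + 1 < d) : E (u i) = u k := by
      rw [← hbu ⟨i, by lia⟩, hE, b.constr_basis, if_neg (by simpa [Fin.lt_def] using h),
        if_neg h'.ne]
    have hElast {i : ℕ} (h' : i + 1 = d) : E (u i) = u i + (u d - u k) := by
      rw [← hbu ⟨i, by lia⟩, hE, b.constr_basis, if_neg (by rw [Fin.lt_def]; simp; lia),
        if_pos h', hbu]
    have hEr : E (u d - u k) = 0 := by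
      rw [map_sub, sub_eq_zero]
      conv_lhs => rw [← b.sum_repr (u d), map_sum]
      rw [Finset.sum_eq_single k, hk1, one_smul, hbu]
      · intro i _ hik
        rcases lt_or_gt_of_ne hik with h | h
        · rw [map_smul, hbu, hElt h, smul_zero]
        · rw [hmax i h, zero_smul, map_zero]
      · simp
    obtain ⟨N, hN⟩ : ∃ N, N = f - E := ⟨_, rfl⟩
    have hNlt {i : ℕ} (h : i < k) : N (u i) = u (i + 1) := by
      rw [hN, LinearMap.sub_apply, hfu, hElt h, sub_zero]
    have hNmid {i : ℕ} (h : k ≤ i) (h' : i + 1 < d) : N (u i) = u (i + 1) - u k := by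
      rw [hN, LinearMap.sub_apply, hfu, hEmid h h']
    have hNlast {i : ℕ} (h' : i + 1 = d) : N (u i) = u k - u i := by
      rw [hN, LinearMap.sub_apply, hfu, hElast h', h']
      abel
    have hpow_le (i : ℕ) (h : i ≤ k) : (N ^ i) v = u i := by
      induction i with
      | zero => simp [hu]
      | succ i ih => rw [pow_succ', Module.End.mul_apply, ih (by lia), hNlt (by lia)]
    have hpow_gt (i : ℕ) (h : k ≤ i) (h' : i + 1 < d) : (N ^ (i + 1)) v = u (i + 1) - u i := by
      induction i, h using Nat.le_induction with
      | base => rw [pow_succ', Module.End.mul_apply, hpow_le _ le_rfl, hNmid le_rfl h']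
      | succ i hi ih =>
        rw [pow_succ', Module.End.mul_apply, ih (by lia), map_sub, hNmid (by lia) h',
          hNmid hi (by lia), sub_sub_sub_cancel_right]
    have hpow_d : (N ^ d) v = 0 := by
      obtain ⟨m, rfl⟩ : ∃ m, d = m + 1 := ⟨d - 1, by lia⟩
      rw [pow_succ', Module.End.mul_apply]
      rcases (Nat.lt_succ_iff.1 hkd).eq_or_lt with h | h
      · rw [← h, hpow_le _ le_rfl, hNlast (by rw [h]), sub_self]
      · obtain ⟨j, rfl⟩ : ∃ j, m = j + 1 := ⟨m - 1, by lia⟩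
        rw [hpow_gt j (by lia) (by lia), map_sub, hNlast rfl, hNmid (by lia) (by lia),
          ← neg_sub (u (j + 1)) (u k), ZModModule.neg_eq_self, sub_self]
    have hkill (i : ℕ) (h : i < d) : (N ^ d) (u i) = 0 := by
      have hw (j : ℕ) : (N ^ d) ((N ^ j) v) = 0 := by
        rw [← Module.End.mul_apply, ← pow_add, add_comm, pow_add, Module.End.mul_apply, hpow_d,
          map_zero]
      induction i with
      | zero => rw [← hpow_le 0 (Nat.zero_le _), hw]
      | succ i ih =>
        rcases le_or_gt (i + 1) (k : ℕ) with h' | h'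
        · rw [← hpow_le _ h', hw]
        · rw [← sub_add_cancel (u (i + 1)) (u i), ← hpow_gt i (by lia) h, map_add, hw,
            ih (by lia), add_zero]
    refine ⟨E, N, b.ext fun i => ?_, ⟨d, b.ext fun i => ?_⟩, by rw [hN, add_sub_cancel]⟩
    · rw [hbu, Module.End.mul_apply]
      rcases lt_or_ge (i : ℕ) k with h | h
      · rw [hElt h, map_zero]
      · rcases (Nat.succ_le_of_lt i.isLt).eq_or_lt with h' | h'
        · rw [hElast h', map_add, hElast h', hEr, add_zero]
        · rw [hEmid h h', hEmid le_rfl (by lia)]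
    · rw [hbu, hkill _ i.isLt, LinearMap.zero_apply]

theorem isNilClean_of_invariant_isCompl {K V : Type*} [Ring K] [AddCommGroup V] [Module K V]
    (f : Module.End K V) {W U : Submodule K V} (h : IsCompl W U) (hW : ∀ x ∈ W, f x ∈ W)
    (h₁ : IsNilClean (f.restrict hW))
    (h₂ : IsNilClean ((U.projectionOnto W h.symm ∘ₗ f ∘ₗ U.subtype : Module.End K U))) :
    IsNilClean f := by
  obtain ⟨e₁, b₁, he₁, ⟨m, hb₁⟩, h₁⟩ := h₁
  obtain ⟨e₂, b₂, he₂, ⟨k, hb₂⟩, h₂⟩ := h₂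
  set p := W.projectionOnto U h
  set q := U.projectionOnto W h.symm
  have hpq (x : V) : (p x : V) + q x = x := Submodule.projection_add_projection_eq_self h x
  have hpW (x : W) : p x = x := Submodule.projectionOnto_apply_left h x
  have hqU (x : U) : q x = x := Submodule.projectionOnto_apply_left h.symm x
  have hpU (x : U) : p x = 0 := Submodule.projectionOnto_apply_right h x
  have hqW (x : W) : q x = 0 := Submodule.projectionOnto_apply_right h.symm x
  obtain ⟨E, hE⟩ : ∃ E : Module.End K V, ∀ x, E x = e₁ (p x) + e₂ (q x) :=
    ⟨W.subtype ∘ₗ e₁ ∘ₗ p + U.subtype ∘ₗ e₂ ∘ₗ q, fun _ => rfl⟩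
  have hidem : IsIdempotentElem E := by
    ext x
    have he₁' (y : W) : e₁ (e₁ y) = e₁ y := LinearMap.congr_fun he₁ y
    have he₂' (y : U) : e₂ (e₂ y) = e₂ y := LinearMap.congr_fun he₂ y
    simp [hE, hpW, hqU, hpU, hqW, he₁', he₂']
  obtain ⟨N, hN⟩ : ∃ N, N = f - E := ⟨_, rfl⟩
  have hNW (x : W) : N x = b₁ x := by
    have := congrArg Subtype.val (LinearMap.congr_fun h₁ x)
    simp only [LinearMap.restrict_apply, LinearMap.add_apply, Submodule.coe_add] at this
    simp [hN, hE, hpW, hqW, this]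
  have hqN (x : V) : q (N x) = b₂ (q x) := by
    have h₂' := LinearMap.congr_fun h₂ (q x)
    simp only [LinearMap.comp_apply, Submodule.subtype_apply, LinearMap.add_apply] at h₂'
    have hfx : q (f x) = q (f (q x)) := by
      conv_lhs => rw [← hpq x, map_add, map_add, hqW ⟨_, hW _ (p x).2⟩, zero_add]
    simp [hN, hE, hqW, hqU, hfx, h₂']
  have hNW' (j : ℕ) (x : W) : (N ^ j) x = (b₁ ^ j) x := by
    induction j with
    | zero => rfl
    | succ j ih => rw [pow_succ', pow_succ', Module.End.mul_apply, ih, hNW, Module.End.mul_apply]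
  have hqN' (j : ℕ) (x : V) : q ((N ^ j) x) = (b₂ ^ j) (q x) := by
    induction j with
    | zero => rfl
    | succ j ih => rw [pow_succ', pow_succ', Module.End.mul_apply, hqN, ih, Module.End.mul_apply]
  refine ⟨E, N, hidem, ⟨m + k, LinearMap.ext fun x => ?_⟩, by rw [hN, add_sub_cancel]⟩
  have hx : (N ^ k) x = p ((N ^ k) x) := by
    conv_lhs => rw [← hpq ((N ^ k) x), hqN', hb₂]
    simp
  rw [pow_add, Module.End.mul_apply, hx, hNW', hb₁]
  simp

theorem exists_linearIndependent_pow_apply {K V : Type*} [Field K] [AddCommGroup V] [Module K V]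
    [FiniteDimensional K V] (f : Module.End K V) (v : V) :
    ∃ d : ℕ, LinearIndependent K (fun i : Fin d => (f ^ (i : ℕ)) v) ∧
      (f ^ d) v ∈ Submodule.span K (Set.range fun i : Fin d => (f ^ (i : ℕ)) v) := by
  by_contra! hcon
  have hli (d : ℕ) : LinearIndependent K (fun i : Fin d => (f ^ (i : ℕ)) v) := by
    induction d with
    | zero => exact linearIndependent_empty_type
    | succ d ih =>
      have := linearIndependent_finSnoc.2 ⟨ih, hcon d ih⟩
      convert this using 1
      ext i
      refine Fin.lastCases ?_ (fun i => ?_) i <;> simp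
  simpa using (hli (Module.finrank K V + 1)).fintype_card_le_finrank

theorem isNilClean_end_zmod_two {V : Type*} [AddCommGroup V] [Module (ZMod 2) V]
    [FiniteDimensional (ZMod 2) V] (f : Module.End (ZMod 2) V) : IsNilClean f := by
  induction hn : Module.finrank (ZMod 2) V using Nat.strong_induction_on generalizing V with
  | _ n ih =>
  subst hn
  rcases subsingleton_or_nontrivial V with hV | hV
  · exact ⟨0, 0, .zero, .zero, Subsingleton.elim _ _⟩
  obtain ⟨v, hv⟩ := exists_ne (0 : V)
  obtain ⟨d, hli, hmem⟩ := exists_linearIndependent_pow_apply f v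
  set W := Submodule.span (ZMod 2) (Set.range fun i : Fin d => (f ^ (i : ℕ)) v) with hWdef
  have hpow {i : ℕ} (hi : i ≤ d) : (f ^ i) v ∈ W := by
    rcases hi.eq_or_lt with rfl | hi
    · exact hmem
    · exact Submodule.subset_span ⟨⟨i, hi⟩, rfl⟩
  have hW : ∀ x ∈ W, f x ∈ W := by
    intro x hx
    have : W ≤ W.comap f := by
      conv_lhs => rw [hWdef]
      rw [Submodule.span_le]
      rintro _ ⟨i, rfl⟩
      have := hpow (Nat.succ_le_of_lt i.isLt)
      rwa [Nat.succ_eq_add_one, pow_succ'] at this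
    exact this hx
  obtain ⟨U, hU⟩ := W.exists_isCompl
  refine isNilClean_of_invariant_isCompl f hU hW ?_ (ih _ ?_ _ rfl)
  · refine isNilClean_of_cyclic (f.restrict hW) ⟨v, hpow (Nat.zero_le d)⟩ (Module.Basis.span hli)
      fun i => Subtype.ext ?_
    rw [Module.Basis.span_apply, Module.End.pow_restrict, LinearMap.coe_restrict_apply]
  · refine Submodule.finrank_lt ?_
    rintro rfl
    have hWbot : W = ⊥ := by simpa using hU.inf_eq_bot
    exact hv (by simpa [hWbot] using hpow (Nat.zero_le d))

theorem IsNilClean.map {R S : Type*} [Ring R] [Ring S] {a : R} (h : IsNilClean a) (f : R →+* S) :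
    IsNilClean (f a) := by
  obtain ⟨e, b, he, hb, rfl⟩ := h
  exact ⟨f e, f b, he.map f, hb.map f, map_add f e b⟩

theorem IsNilClean.of_map {R S : Type*} [Ring R] [Ring S] (f : R →+* S)
    (hf : ∀ x ∈ RingHom.ker f, IsNilpotent x) {a e : R} (he : IsIdempotentElem (f e))
    (hb : IsNilpotent (f (a - e))) : IsNilClean a := by
  obtain ⟨e', he', hfe⟩ := exists_isIdempotentElem_eq_of_ker_isNilpotent f hf (f e) ⟨e, rfl⟩ he
  refine ⟨e', a - e', he', ?_, (add_sub_cancel e' a).symm⟩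
  obtain ⟨k, hk⟩ := hb
  refine IsNilpotent.of_pow (m := k) (hf _ ?_)
  rw [RingHom.mem_ker, map_pow, map_sub, hfe, ← map_sub, hk]

theorem isNilClean_matrix_zmod_two {ι : Type*} [Fintype ι] [DecidableEq ι]
    (A : Matrix ι ι (ZMod 2)) : IsNilClean A := by
  simpa using (isNilClean_end_zmod_two (Matrix.toLinAlgEquiv' A)).map
    (Matrix.toLinAlgEquiv' (R := ZMod 2) (n := ι)).symm.toRingEquiv.toRingHom

theorem Matrix.isNilpotent_of_forall_isNilpotent {R ι : Type*} [CommRing R] [Fintype ι]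
    [DecidableEq ι] {M : Matrix ι ι R} (hM : ∀ i j, IsNilpotent (M i j)) : IsNilpotent M := by
  set I := Ideal.span (Set.range fun p : ι × ι => M p.1 p.2)
  have hI : I.FG := Submodule.fg_span (Set.finite_range _)
  obtain ⟨k, hk⟩ := hI.isNilpotent_iff_le_nilradical.2 (Ideal.span_le.2 (by
    rintro _ ⟨p, rfl⟩
    exact hM p.1 p.2))
  have hpow (m : ℕ) (i j : ι) : (M ^ m) i j ∈ I ^ m := by
    induction m generalizing i j with
    | zero => simp
    | succ m ih =>
      rw [pow_succ, pow_succ, Matrix.mul_apply]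
      exact sum_mem fun l _ => Ideal.mul_mem_mul (ih i l) (Ideal.subset_span ⟨(l, j), rfl⟩)
  exact ⟨k, Matrix.ext fun i j => by simpa [hk] using hpow k i j⟩

theorem Matrix.isNilpotent_of_mem_ker_mapMatrix {R S ι : Type*} [CommRing R] [CommRing S]
    [Fintype ι] [DecidableEq ι] (f : R →+* S) (hf : ∀ x ∈ RingHom.ker f, IsNilpotent x)
    (M : Matrix ι ι R) (hM : M ∈ RingHom.ker (f.mapMatrix (m := ι))) : IsNilpotent M :=
  Matrix.isNilpotent_of_forall_isNilpotent fun i j => hf _ (congrFun (congrFun hM i) j)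

theorem exists_mvPolynomial_int_aeval_eq {σ : Type*} [Finite σ] (g : (σ → ZMod 2) → ZMod 2) :
    ∃ P : MvPolynomial σ ℤ, ∀ v, MvPolynomial.aeval v P = g v := by
  have hg : g ∈ Submodule.map (MvPolynomial.evalₗ (ZMod 2) σ) _ :=
    (MvPolynomial.map_restrict_dom_evalₗ (ZMod 2) σ).symm ▸ Submodule.mem_top (x := g)
  obtain ⟨Q, -, rfl⟩ := hg
  obtain ⟨P, rfl⟩ := MvPolynomial.map_surjective (Int.castRingHom (ZMod 2))
    (ZMod.ringHom_surjective _) Q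
  refine ⟨P, fun v => ?_⟩
  rw [MvPolynomial.evalₗ_apply, MvPolynomial.eval_map, MvPolynomial.aeval_def]
  rfl

theorem exists_ringHom_zmod_two_of_eq_zero_or_one {K : Type*} [CommRing K] [Nontrivial K]
    (hK : ∀ x : K, x = 0 ∨ x = 1) :
    ∃ ψ : ZMod 2 →+* K, Function.Surjective ψ := by
  have h2 : (2 : K) = 0 := (hK 2).resolve_right fun h =>
    one_ne_zero (α := K) (by linear_combination h)
  have := CharTwo.of_one_ne_zero_of_two_eq_zero (one_ne_zero (α := K)) h2
  refine ⟨ZMod.castHom dvd_rfl K, fun x => ?_⟩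
  rcases hK x with rfl | rfl
  · exact ⟨0, map_zero _⟩
  · exact ⟨1, map_one _⟩

theorem exists_matrix_forall_isIdempotentElem_map {R ι : Type*} [CommRing R] [Fintype ι]
    [DecidableEq ι] (A : Matrix ι ι R) :
    ∃ (E : Matrix ι ι R) (k : ℕ), ∀ m : Ideal R, ∀ ψ : ZMod 2 →+* R ⧸ m, Function.Surjective ψ →
      IsIdempotentElem ((Ideal.Quotient.mk m).mapMatrix E) ∧
        (Ideal.Quotient.mk m).mapMatrix (A - E) ^ k = 0 := by
  choose e b he hb heb using isNilClean_matrix_zmod_two (ι := ι)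
  obtain ⟨k, hk⟩ : ∃ k, ∀ B, (B - e B) ^ k = 0 := by
    choose k hk using hb
    refine ⟨∑ B, k B, fun B => ?_⟩
    rw [sub_eq_of_eq_add' (heb B)]
    exact pow_eq_zero_of_le (Finset.single_le_sum (fun _ _ => Nat.zero_le _)
      (Finset.mem_univ B)) (hk B)
  choose P hP using fun i j => exists_mvPolynomial_int_aeval_eq
    fun v : ι × ι → ZMod 2 => e (Matrix.of fun i j => v (i, j)) i j
  refine ⟨Matrix.of fun i j => MvPolynomial.aeval (fun p => A p.1 p.2) (P i j), k,
    fun m ψ hψ => ?_⟩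
  choose s hs using hψ
  generalize hφ : Ideal.Quotient.mk m = φ
  obtain ⟨B, hB⟩ : ∃ B : Matrix ι ι (ZMod 2), ∀ i j, ψ (B i j) = φ (A i j) :=
    ⟨Matrix.of fun i j => s (φ (A i j)), fun i j => hs _⟩
  have hA : φ.mapMatrix A = ψ.mapMatrix B := Matrix.ext fun i j => (hB i j).symm
  have hE : φ.mapMatrix (Matrix.of fun i j => MvPolynomial.aeval (fun p => A p.1 p.2) (P i j)) =
      ψ.mapMatrix (e B) := by
    refine Matrix.ext fun i j => ?_
    have h₁ := MvPolynomial.map_aeval (fun p : ι × ι => A p.1 p.2) φ (P i j)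
    have h₂ := MvPolynomial.map_aeval (fun p : ι × ι => B p.1 p.2) ψ (P i j)
    rw [hP] at h₂
    refine h₁.trans (Eq.trans ?_ h₂.symm)
    simp only [hB]
    exact congrArg (fun g => MvPolynomial.eval₂Hom g _ _) (RingHom.ext_int _ _)
  rw [map_sub, hE, hA, ← map_sub, ← map_pow, hk, map_zero]
  exact ⟨(he B).map _, rfl⟩

theorem Matrix.mapMatrix_mk_jacobson_eq_zero {R ι : Type*} [CommRing R] [Fintype ι]
    [DecidableEq ι] {I : Ideal R} {M : Matrix ι ι R}
    (hM : ∀ m : Ideal R, I ≤ m → m.IsMaximal → (Ideal.Quotient.mk m).mapMatrix M = 0) :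
    (Ideal.Quotient.mk I.jacobson).mapMatrix M = 0 := by
  ext i j
  refine Ideal.Quotient.eq_zero_iff_mem.2 (Ideal.mem_sInf.2 fun {m} hm => ?_)
  exact Ideal.Quotient.eq_zero_iff_mem.1 (congrFun (congrFun (hM m hm.1 hm.2) i) j)

theorem isNilClean_matrix_of_isIdempotentElem_quotient {R ι : Type*} [CommRing R] [Fintype ι]
    [DecidableEq ι] (hnil : ∀ x ∈ Ideal.jacobson (⊥ : Ideal R), IsNilpotent x)
    (hbool : ∀ a : R ⧸ Ideal.jacobson (⊥ : Ideal R), IsIdempotentElem a) (A : Matrix ι ι R) :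
    IsNilClean A := by
  obtain ⟨E, k, hEk⟩ := exists_matrix_forall_isIdempotentElem_map A
  have key (m : Ideal R) (hm : m.IsMaximal) :
      IsIdempotentElem ((Ideal.Quotient.mk m).mapMatrix E) ∧
        (Ideal.Quotient.mk m).mapMatrix (A - E) ^ k = 0 := by
    have hK (x : R ⧸ m) : x = 0 ∨ x = 1 := by
      obtain ⟨a, rfl⟩ := Ideal.Quotient.mk_surjective x
      have ha : a * a - a ∈ Ideal.jacobson (⊥ : Ideal R) := by
        rw [← Ideal.Quotient.eq, map_mul]
        exact hbool _
      have ha' := (Ideal.mem_sInf.1 ha) (I := m) ⟨bot_le, hm⟩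
      rw [← Ideal.Quotient.eq, map_mul] at ha'
      exact IsIdempotentElem.iff_eq_zero_or_one.1 ha'
    obtain ⟨ψ, hψ⟩ := exists_ringHom_zmod_two_of_eq_zero_or_one hK
    exact hEk m ψ hψ
  have hE : IsIdempotentElem ((Ideal.Quotient.mk (Ideal.jacobson (⊥ : Ideal R))).mapMatrix E) := by
    rw [IsIdempotentElem, ← map_mul, ← sub_eq_zero, ← map_sub]
    refine Matrix.mapMatrix_mk_jacobson_eq_zero fun m _ hm => ?_
    rw [map_sub, map_mul, (key m hm).1.eq, sub_self]
  have hAE : (Ideal.Quotient.mk (Ideal.jacobson (⊥ : Ideal R))).mapMatrix (A - E) ^ k = 0 := by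
    rw [← map_pow]
    refine Matrix.mapMatrix_mk_jacobson_eq_zero fun m _ hm => ?_
    rw [map_pow, (key m hm).2]
  refine IsNilClean.of_map (Ideal.Quotient.mk (Ideal.jacobson (⊥ : Ideal R))).mapMatrix
    (fun M hM => ?_) hE ⟨k, hAE⟩
  exact Matrix.isNilpotent_of_mem_ker_mapMatrix _ (by simpa only [Ideal.mk_ker] using hnil) M hM

theorem IsIdempotentElem.exists_natCast_eq_matrix_trace {K ι : Type*} [Field K] [Fintype ι]
    [DecidableEq ι] {E : Matrix ι ι K} (hE : IsIdempotentElem E) : ∃ r : ℕ, E.trace = r := by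
  have h : IsIdempotentElem (Matrix.toLin' E) := by
    rw [IsIdempotentElem, Module.End.mul_eq_comp, ← Matrix.toLin'_mul, hE.eq]
  exact ⟨_, by rw [← Matrix.trace_toLin'_eq, (LinearMap.IsIdempotentElem.isProj_range _ h).trace]⟩

theorem IsUNCRing.isNilpotent_sub_one {R S : Type*} [CommRing R] [Ring S] [Algebra R S]
    (h : IsUNCRing S) (hinj : Function.Injective (algebraMap R S)) (u : Rˣ) :
    IsNilpotent ((u : R) - 1) := by
  obtain ⟨e, b, he, hb, heb⟩ := h (u.map (algebraMap R S).toMonoidHom)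
  replace heb : algebraMap R S u = e + b := heb
  have hu : IsUnit (algebraMap R S u) := u.isUnit.map (algebraMap R S)
  have hbe : b = algebraMap R S u - e := eq_sub_of_add_eq' heb.symm
  have hcomm : Commute (1 - e) b := by
    rw [hbe]
    exact ((Commute.one_left _).sub_left (Algebra.commute_algebraMap_right _ _)).sub_right
      ((Commute.one_left _).sub_left (Commute.refl e))
  have hmul : (1 - e) * b = algebraMap R S u * (1 - e) := by
    rw [hbe, mul_sub, (Algebra.commutes (u : R) (1 - e)).symm, sub_mul 1 e e, he.eq, one_mul,
      sub_self, sub_zero]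
  obtain ⟨k, hk⟩ := hcomm.isNilpotent_mul_left hb
  rw [hmul, (Algebra.commute_algebraMap_left (u : R) (1 - e)).mul_pow,
    (hu.pow k).mul_right_eq_zero] at hk
  have he1 : e = 1 := by
    rcases k with _ | k
    · rw [pow_zero] at hk
      exact eq_of_zero_eq_one hk.symm _ _
    · rw [he.one_sub.pow_succ_eq, sub_eq_zero] at hk
      exact hk.symm
  rw [he1] at hbe
  refine (IsNilpotent.map_iff hinj).1 ?_
  rwa [map_sub, map_one, ← hbe]

theorem Matrix.algebraMap_self_injective {R ι : Type*} [CommRing R] [Fintype ι] [DecidableEq ι]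
    [Nonempty ι] : Function.Injective (algebraMap R (Matrix ι ι R)) := fun _ _ h =>
  Matrix.scalar_inj.1 h

theorem Matrix.exists_unit_trace_eq_add_card {R ι : Type*} [CommRing R] [Fintype ι]
    [DecidableEq ι] [Nontrivial ι] (a : R) :
    ∃ u : (Matrix ι ι R)ˣ, (u : Matrix ι ι R).trace = a + Fintype.card ι := by
  obtain ⟨i, j, hij⟩ := exists_pair_ne ι
  have hu : IsUnit (Matrix.transvection i j a * Matrix.transvection j i (1 : R)) := by
    rw [Matrix.isUnit_iff_isUnit_det, Matrix.det_mul, Matrix.det_transvection_of_ne _ _ hij,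
      Matrix.det_transvection_of_ne _ _ hij.symm, one_mul]
    exact isUnit_one
  refine ⟨hu.unit, ?_⟩
  simp [Matrix.transvection, mul_add, add_mul, hij, hij.symm, Matrix.trace_single_eq_of_ne]
  ring

theorem IsUNCRing.eq_zero_or_eq_one_of_matrix {R K ι : Type*} [CommRing R] [Field K] [Fintype ι]
    [DecidableEq ι] [Nontrivial ι] (h : IsUNCRing (Matrix ι ι R)) (φ : R →+* K) (a : R) :
    φ a = 0 ∨ φ a = 1 := by
  have h2 : (2 : K) = 0 := by
    have := ((h.isNilpotent_sub_one Matrix.algebraMap_self_injective (-1 : Rˣ)).map φ).eq_zero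
    rw [map_sub, Units.val_neg, map_neg, Units.val_one, map_one] at this
    linear_combination -this
  have := CharTwo.of_one_ne_zero_of_two_eq_zero (one_ne_zero (α := K)) h2
  obtain ⟨u, hu⟩ := Matrix.exists_unit_trace_eq_add_card (ι := ι) (a - Fintype.card ι)
  obtain ⟨e, b, he, hb, heb⟩ := (h u).map φ.mapMatrix
  obtain ⟨r, hr⟩ := he.exists_natCast_eq_matrix_trace
  have htr : φ a = r := by
    rw [← hr, ← add_zero e.trace, ← (Matrix.isNilpotent_trace_of_isNilpotent hb).eq_zero,
      ← Matrix.trace_add, ← heb, RingHom.mapMatrix_apply, ← AddMonoidHom.map_trace φ, hu,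
      sub_add_cancel]
  rw [htr]
  rcases Nat.even_or_odd r with hr | hr
  · exact .inl (by rw [CharTwo.natCast_eq_ite, if_pos hr])
  · exact .inr (by rw [CharTwo.natCast_eq_ite, if_neg (Nat.not_even_iff_odd.2 hr)])

/-- For a commutative ring `R` and `n ≥ 2`, the matrix ring `Mₙ(R)` is a UNC
ring iff `J(R)` is nil and `R/J(R)` is Boolean. -/
theorem stmt_8 (R : Type*) [CommRing R] (n : ℕ) (hn : 2 ≤ n) :
    IsUNCRing (Matrix (Fin n) (Fin n) R) ↔
      (∀ x ∈ Ideal.jacobson (⊥ : Ideal R), IsNilpotent x) ∧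
        ∀ a : R ⧸ Ideal.jacobson (⊥ : Ideal R), IsIdempotentElem a := by
  have : Nontrivial (Fin n) := Fin.nontrivial_iff_two_le.2 hn
  refine ⟨fun h => ⟨fun x hx => ?_, fun a => ?_⟩, fun h u => ?_⟩
  · obtain ⟨u, hu⟩ : IsUnit (x + 1) := by simpa using Ideal.mem_jacobson_bot.1 hx 1
    simpa [hu] using h.isNilpotent_sub_one Matrix.algebraMap_self_injective u
  · obtain ⟨a, rfl⟩ := Ideal.Quotient.mk_surjective a
    rw [IsIdempotentElem, ← map_mul, Ideal.Quotient.eq]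
    refine Ideal.mem_sInf.2 fun {m} hm => ?_
    have : m.IsMaximal := hm.2
    let _ := Ideal.Quotient.field m
    rw [← Ideal.Quotient.eq, map_mul]
    exact IsIdempotentElem.iff_eq_zero_or_one.2
      (h.eq_zero_or_eq_one_of_matrix (Ideal.Quotient.mk m) a)
  · exact isNilClean_matrix_of_isIdempotentElem_quotient h.1 h.2 (u : Matrix (Fin n) (Fin n) R)
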